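/- For every circuit encoding v (that is, every v ∈ X ∪ Y): v ∈ X if and only if v does not belong to the language concatenation ({a}*·{b})·X and v does not belong to the language concatenation L₀·X. (This is the formal statement that the set of encodings of value-1 circuits satisfies, on well-formed circuit encodings, the language equation X = complement({a}*{b}·X) ∩ complement(L₀·X).) -/

import Mathlib

/-- The two-letter alphabet Σ = {a, b}. -/
inductive Letter : Type
  | a
  | b
deriving DecidableEq

/-- The encoding of the sequential NOR circuit with `n` gates and indices `j`:
the string a^{n−jₙ−1} b · a^{(n−1)−jₙ₋₁−1} b · ⋯ · a^{2−j₂−1} b, where the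
one-gate circuit is encoded by the empty string ε. -/
def encC (j : ℕ → ℕ) : ℕ → List Letter
  | 0 => []
  | 1 => []
  | (i + 2) =>
      (List.replicate ((i + 2) - j (i + 2) - 1) Letter.a ++ [Letter.b]) ++
        encC j (i + 1)

/-- The indices j₂, …, jₙ of a sequential NOR circuit satisfy 1 ≤ jᵢ < i. -/
def ValidIdx (j : ℕ → ℕ) (n : ℕ) : Prop :=
  ∀ i, 2 ≤ i → i ≤ n → 1 ≤ j i ∧ j i < i

/-- `x` gives the gate values of the circuit with indices `j` and `n` gates:
x₁ = 1 and xᵢ = ¬(xᵢ₋₁ ∨ x_{jᵢ}) for 2 ≤ i ≤ n. -/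
def GateVals (j : ℕ → ℕ) (n : ℕ) (x : ℕ → Bool) : Prop :=
  x 1 = true ∧ ∀ i, 2 ≤ i → i ≤ n → x i = !(x (i - 1) || x (j i))

/-- `X`: the language of encodings of sequential NOR circuits whose output
gate has value 1. -/
def XL : Language Letter :=
  { v | ∃ n j x, 1 ≤ n ∧ ValidIdx j n ∧ GateVals j n x ∧
          v = encC j n ∧ x n = true }

/-- `Y`: the language of encodings of sequential NOR circuits whose output
gate has value 0. -/
def YL : Language Letter :=
  { v | ∃ n j x, 1 ≤ n ∧ ValidIdx j n ∧ GateVals j n x ∧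
          v = encC j n ∧ x n = false }

/-- The language {a}*·{b}. -/
def AstarB : Language Letter :=
  { w | ∃ k, w = List.replicate k Letter.a ++ [Letter.b] }

/-- The language L₀ = ⋃_{m ≥ 0} {a}ᵐ·{b}·({a}*·{b})ᵐ. -/
def L0 : Language Letter :=
  { w | ∃ m, w ∈ ({List.replicate m Letter.a ++ [Letter.b]} : Language Letter)
                * AstarB ^ m }

theorem block_append_inj {k l : ℕ} {u v : List Letter}
    (h : (List.replicate k Letter.a ++ [Letter.b]) ++ u =
      (List.replicate l Letter.a ++ [Letter.b]) ++ v) : k = l ∧ u = v := by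
  induction k generalizing l with
  | zero => cases l <;> simp_all [List.replicate_succ]
  | succ k ih =>
    cases l with
    | zero => simp [List.replicate_succ] at h
    | succ l =>
      obtain ⟨rfl, rfl⟩ := ih (l := l) (by simpa [List.replicate_succ] using h)
      exact ⟨rfl, rfl⟩

theorem encC_inj {j j' : ℕ → ℕ} {n n' : ℕ} (hn : 1 ≤ n) (hn' : 1 ≤ n')
    (hj : ValidIdx j n) (hj' : ValidIdx j' n') (h : encC j n = encC j' n') :
    n = n' ∧ ∀ i, 2 ≤ i → i ≤ n → j i = j' i := by
  induction n, hn using Nat.le_induction generalizing n' with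
  | base =>
    match n', hn' with
    | 1, _ => exact ⟨rfl, by omega⟩
    | k + 2, _ => simp [encC] at h
  | succ n hn ih =>
    obtain ⟨n, rfl⟩ := Nat.exists_eq_add_of_le' hn
    match n', hn' with
    | 1, _ => simp [encC] at h
    | k + 2, _ =>
      obtain ⟨hk, ht⟩ := block_append_inj h
      obtain ⟨hnk, hi⟩ := ih (n' := k + 1) (by omega)
        (fun i h2 hi => hj i h2 (by omega)) (fun i h2 hi => hj' i h2 (by omega)) ht
      obtain rfl : n = k := by omega
      refine ⟨rfl, fun i h2 hin => ?_⟩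
      rcases Nat.lt_or_ge i (n + 2) with hlt | hge
      · exact hi i h2 (by omega)
      · obtain rfl : i = n + 2 := by omega
        have h₁ := hj (n + 2) (by omega) le_rfl
        have h₂ := hj' (n + 2) (by omega) le_rfl
        omega

theorem GateVals.eq_of_idx_eq {j j' : ℕ → ℕ} {n : ℕ} {x x' : ℕ → Bool}
    (hj : ValidIdx j n) (hx : GateVals j n x) (hx' : GateVals j' n x')
    (h : ∀ i, 2 ≤ i → i ≤ n → j i = j' i) (i : ℕ) (hi : 1 ≤ i) (hin : i ≤ n) :
    x i = x' i := by
  induction i using Nat.strong_induction_on with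
  | _ i ih =>
    rcases Nat.lt_or_ge i 2 with hlt | hge
    · obtain rfl : i = 1 := by omega
      rw [hx.1, hx'.1]
    · have hv := hj i hge hin
      rw [hx.2 i hge hin, hx'.2 i hge hin, ← h i hge hin,
        ih (i - 1) (by omega) (by omega) (by omega),
        ih (j i) (by omega) (by omega) (by omega)]

theorem encC_mem_XL_iff {j : ℕ → ℕ} {n : ℕ} {x : ℕ → Bool}
    (hj : ValidIdx j n) (hx : GateVals j n x) {i : ℕ} (hi : 1 ≤ i) (hin : i ≤ n) :
    encC j i ∈ XL ↔ x i = true := by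
  have hji : ValidIdx j i := fun l h2 hl => hj l h2 (hl.trans hin)
  have hxi : GateVals j i x := ⟨hx.1, fun l h2 hl => hx.2 l h2 (hl.trans hin)⟩
  constructor
  · rintro ⟨n', j', x', hn', hj', hx', he, hv⟩
    obtain ⟨rfl, hjj⟩ := encC_inj hi hn' hji hj' he
    rw [hxi.eq_of_idx_eq hji hx' hjj i hi le_rfl, hv]
  · exact fun h => ⟨i, j, x, hi, hji, hxi, rfl, h⟩

theorem eq_encC_of_append_eq {j : ℕ → ℕ} {m n : ℕ} {w u : List Letter} (hn : 1 ≤ n)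
    (hw : w ∈ AstarB ^ m) (h : w ++ u = encC j n) : m < n ∧ u = encC j (n - m) := by
  induction m generalizing w n with
  | zero =>
    rw [pow_zero, Language.mem_one] at hw
    subst hw
    exact ⟨hn, h⟩
  | succ m ih =>
    rw [pow_succ', Language.mem_mul] at hw
    obtain ⟨_, ⟨k, rfl⟩, t, ht, rfl⟩ := hw
    match n, hn with
    | 1, _ => simp [encC] at h
    | n + 2, _ =>
      rw [List.append_assoc] at h
      obtain ⟨hlt, hu⟩ := ih (n := n + 1) (by omega) ht (block_append_inj h).2
      exact ⟨by omega, by rw [hu]; congr 1; omega⟩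

theorem exists_append_encC (j : ℕ → ℕ) {m n : ℕ} (h : m < n) :
    ∃ w ∈ AstarB ^ m, w ++ encC j (n - m) = encC j n := by
  induction m generalizing n with
  | zero => exact ⟨[], by simp [Language.mem_one], rfl⟩
  | succ m ih =>
    obtain ⟨n, rfl⟩ : ∃ k, n = k + 2 := ⟨n - 2, by omega⟩
    obtain ⟨w, hw, he⟩ := ih (n := n + 1) (by omega)
    refine ⟨(List.replicate (n + 2 - j (n + 2) - 1) Letter.a ++ [Letter.b]) ++ w, ?_, ?_⟩
    · rw [pow_succ', Language.mem_mul]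
      exact ⟨_, ⟨_, rfl⟩, w, hw, rfl⟩
    · rw [show n + 2 - (m + 1) = n + 1 - m by omega, List.append_assoc, he, encC]

theorem encC_mem_AstarB_mul_iff (j : ℕ → ℕ) (n : ℕ) (K : Language Letter) :
    encC j (n + 2) ∈ AstarB * K ↔ encC j (n + 1) ∈ K := by
  rw [Language.mem_mul]
  constructor
  · rintro ⟨_, ⟨k, rfl⟩, u, hu, h⟩
    rwa [← (block_append_inj h).2]
  · exact fun h => ⟨_, ⟨_, rfl⟩, _, h, rfl⟩

theorem encC_mem_L0_mul_iff {j : ℕ → ℕ} {n : ℕ} (hj : ValidIdx j (n + 2))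
    (K : Language Letter) : encC j (n + 2) ∈ L0 * K ↔ encC j (j (n + 2)) ∈ K := by
  have hv := hj (n + 2) (by omega) le_rfl
  have hidx : n + 1 - (n + 2 - j (n + 2) - 1) = j (n + 2) := by omega
  rw [Language.mem_mul]
  constructor
  · rintro ⟨_, ⟨m, hm⟩, u, hu, h⟩
    rw [Language.mem_mul] at hm
    obtain ⟨_, rfl, w, hw, rfl⟩ := hm
    rw [List.append_assoc] at h
    obtain ⟨rfl, ht⟩ := block_append_inj h
    obtain ⟨-, rfl⟩ := eq_encC_of_append_eq (by omega) hw ht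
    rwa [hidx] at hu
  · intro h
    obtain ⟨w, hw, he⟩ := exists_append_encC j
      (show n + 2 - j (n + 2) - 1 < n + 1 by omega)
    rw [hidx] at he
    refine ⟨_, ⟨n + 2 - j (n + 2) - 1, Language.mem_mul.2 ⟨_, rfl, w, hw, rfl⟩⟩, _, h, ?_⟩
    rw [List.append_assoc, he, encC]

theorem nil_notMem_AstarB_mul (K : Language Letter) : [] ∉ AstarB * K := by
  rw [Language.mem_mul]
  rintro ⟨_, ⟨k, rfl⟩, u, -, h⟩
  simp at h

theorem nil_notMem_L0_mul (K : Language Letter) : [] ∉ L0 * K := by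
  rw [Language.mem_mul]
  rintro ⟨_, ⟨m, hm⟩, u, -, h⟩
  rw [Language.mem_mul] at hm
  obtain ⟨_, rfl, w, -, rfl⟩ := hm
  simp at h

/-- For every circuit encoding v (that is, every v ∈ X ∪ Y):
v ∈ X iff v ∉ ({a}*·{b})·X and v ∉ L₀·X. That is, on well-formed circuit
encodings, X satisfies the language equation
X = complement({a}*{b}·X) ∩ complement(L₀·X). -/
theorem statement5 :
    ∀ v : List Letter, v ∈ XL ∨ v ∈ YL →
      (v ∈ XL ↔ v ∉ AstarB * XL ∧ v ∉ L0 * XL) := by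
  intro v hv
  obtain ⟨n, j, x, hn, hj, hx, rfl⟩ :
      ∃ n j x, 1 ≤ n ∧ ValidIdx j n ∧ GateVals j n x ∧ v = encC j n := by
    rcases hv with ⟨n, j, x, hn, hj, hx, h, -⟩ | ⟨n, j, x, hn, hj, hx, h, -⟩ <;>
      exact ⟨n, j, x, hn, hj, hx, h⟩
  match n, hn with
  | 1, _ =>
    rw [encC_mem_XL_iff hj hx le_rfl le_rfl, encC]
    exact iff_of_true hx.1 ⟨nil_notMem_AstarB_mul XL, nil_notMem_L0_mul XL⟩
  | n + 2, hn =>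
    have hidx := hj (n + 2) (by omega) le_rfl
    rw [encC_mem_AstarB_mul_iff, encC_mem_L0_mul_iff hj,
      encC_mem_XL_iff hj hx hn le_rfl,
      encC_mem_XL_iff hj hx (by omega : 1 ≤ n + 1) (by omega),
      encC_mem_XL_iff hj hx hidx.1 hidx.2.le, hx.2 (n + 2) (by omega) le_rfl]
    simp
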